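/- For any a ∈ ℂ with Re(a) > 0, ν ∈ ℝ with ν > −1, and r > 0, the integral ∫₀^∞ k^{ν+1}·J_ν(r k)·exp(−a k) dk equals 2a·(2r)^ν·Γ(ν + 3/2) / (√π · (a² + r²)^{ν+3/2}). -/

import Mathlib

/-- Bessel function of the first kind of real order `ν`, defined by its power series. -/
noncomputable def besselJ (ν : ℝ) (x : ℝ) : ℝ :=
  ∑' m : ℕ, ((-1 : ℝ) ^ m / (m.factorial * Real.Gamma (m + ν + 1))) *
    (x / 2) ^ (2 * (m : ℝ) + ν)

section BesselClifford

open Set Filter Topology MeasureTheory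

theorem summable_mul_pow_div_factorial {b : ℕ → ℝ} {B : ℝ} (hb : ∀ n, |b n| ≤ B) (t : ℝ) :
    Summable fun n ↦ b n * (t ^ n / n.factorial) := by
  refine Summable.of_norm_bounded ((Real.summable_pow_div_factorial |t|).mul_left B) fun n ↦ ?_
  rw [Real.norm_eq_abs, abs_mul, abs_div, abs_pow, Nat.abs_cast]
  exact mul_le_mul_of_nonneg_right (hb n) (by positivity)

theorem hasDerivAt_tsum_mul_pow_div_factorial {b : ℕ → ℝ} {B : ℝ} (hb : ∀ n, |b n| ≤ B) (t : ℝ) :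
    HasDerivAt (fun x ↦ ∑' n, b n * (x ^ n / n.factorial))
      (∑' n, b (n + 1) * (t ^ n / n.factorial)) t := by
  have hstep (n : ℕ) (y : ℝ) :
      ((n + 1 : ℕ) : ℝ) * y ^ (n + 1 - 1) / (n + 1).factorial = y ^ n / n.factorial := by
    rw [Nat.factorial_succ, Nat.add_sub_cancel]
    push_cast
    field_simp
  have hu : Summable fun n : ℕ ↦ B * (n * (|t| + 1) ^ (n - 1) / n.factorial) := by
    refine Summable.mul_left B ((summable_nat_add_iff 1).1 ?_)
    simpa only [hstep] using Real.summable_pow_div_factorial (|t| + 1)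
  have ht : t ∈ Metric.ball (0 : ℝ) (|t| + 1) := by simp
  have key := hasDerivAt_tsum_of_isPreconnected (𝕜 := ℝ) (y₀ := t)
    (g := fun n x ↦ b n * (x ^ n / n.factorial))
    (g' := fun n x ↦ b n * (n * x ^ (n - 1) / n.factorial)) hu Metric.isOpen_ball
    (convex_ball (0 : ℝ) (|t| + 1)).isPreconnected
    (fun n y _ ↦ ((hasDerivAt_pow n y).div_const _).const_mul _) ?_ ht
    (summable_mul_pow_div_factorial hb t) ht
  · refine key.congr_deriv ?_
    rw [Summable.tsum_eq_zero_add]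
    · simp only [hstep]; simp
    · refine (summable_nat_add_iff 1).1 ?_
      simp only [hstep]
      exact summable_mul_pow_div_factorial (fun n ↦ hb (n + 1)) t
  · intro n y hy
    have hy' : |y| ≤ |t| + 1 := by simpa using (mem_ball_zero_iff.1 hy).le
    rw [Real.norm_eq_abs, abs_mul, abs_div, abs_mul, abs_pow, Nat.abs_cast, Nat.abs_cast]
    gcongr
    exacts [(abs_nonneg _).trans (hb n), hb n]

theorem exists_inv_Gamma_nat_add_le {δ : ℝ} (hδ : 0 < δ) :
    ∃ B, ∀ m : ℕ, (Real.Gamma (m + δ))⁻¹ ≤ B := by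
  refine ⟨max (Real.Gamma δ)⁻¹ (Real.Gamma (1 + δ))⁻¹, fun m ↦ ?_⟩
  rcases m with _ | m
  · simp
  induction m with
  | zero => simp
  | succ m ih =>
    refine le_trans ?_ ih
    have h : (1 : ℝ) ≤ (m + 1 : ℕ) + δ := by push_cast; linarith [m.cast_nonneg (α := ℝ)]
    have hG := Real.Gamma_pos_of_pos (zero_lt_one.trans_le h)
    rw [Nat.cast_succ (m + 1), add_right_comm, Real.Gamma_add_one (by linarith)]
    exact inv_anti₀ hG (le_mul_of_one_le_left hG.le h)

/-- The Bessel–Clifford function at `-t`, so that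
`J_μ(x) = (x / 2) ^ μ * besselClifford μ ((x / 2) ^ 2)`. -/
noncomputable def besselClifford (μ t : ℝ) : ℝ :=
  ∑' m : ℕ, (-1) ^ m / Real.Gamma (m + (μ + 1)) * (t ^ m / m.factorial)

theorem exists_abs_besselClifford_coeff_le {μ : ℝ} (hμ : -1 < μ) :
    ∃ B, ∀ m : ℕ, |(-1) ^ m / Real.Gamma (m + (μ + 1))| ≤ B := by
  obtain ⟨B, hB⟩ := exists_inv_Gamma_nat_add_le (δ := μ + 1) (by linarith)
  refine ⟨B, fun m ↦ ?_⟩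
  have : 0 < Real.Gamma (m + (μ + 1)) :=
    Real.Gamma_pos_of_pos (by linarith [m.cast_nonneg (α := ℝ)])
  simpa [abs_div, abs_of_pos this] using hB m

theorem hasDerivAt_besselClifford {μ : ℝ} (hμ : -1 < μ) (t : ℝ) :
    HasDerivAt (besselClifford μ) (-besselClifford (μ + 1) t) t := by
  obtain ⟨B, hB⟩ := exists_abs_besselClifford_coeff_le hμ
  refine (hasDerivAt_tsum_mul_pow_div_factorial hB t).congr_deriv ?_
  rw [besselClifford, ← tsum_neg]
  refine tsum_congr fun m ↦ ?_
  rw [Nat.cast_succ, show (m : ℝ) + 1 + (μ + 1) = m + (μ + 1 + 1) by ring, pow_succ]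
  ring

theorem besselClifford_recurrence {μ : ℝ} (hμ : -1 < μ) (t : ℝ) :
    besselClifford μ t = (μ + 1) * besselClifford (μ + 1) t - t * besselClifford (μ + 2) t := by
  obtain ⟨B₁, hB₁⟩ := exists_abs_besselClifford_coeff_le (μ := μ + 1) (by linarith)
  obtain ⟨B₂, hB₂⟩ := exists_abs_besselClifford_coeff_le (μ := μ + 2) (by linarith)
  have h₁ := (summable_mul_pow_div_factorial hB₁ t).hasSum.mul_left (μ + 1)
  have h₂ := (summable_mul_pow_div_factorial hB₂ t).hasSum.mul_left (-t)
  have h₃ : HasSum (fun m : ℕ ↦ m * ((-1) ^ m / Real.Gamma (m + (μ + 1 + 1)) *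
      (t ^ m / m.factorial))) (-t * besselClifford (μ + 2) t) := by
    refine (hasSum_nat_add_iff' 1).1 ?_
    simp only [Finset.range_one, Finset.sum_singleton, Nat.cast_zero, zero_mul, sub_zero]
    refine h₂.congr_fun fun m ↦ ?_
    rw [Nat.factorial_succ, Nat.cast_succ, pow_succ, pow_succ,
      show (m : ℝ) + 1 + (μ + 1 + 1) = m + (μ + 2 + 1) by ring]
    push_cast
    field_simp
  have h := h₁.add h₃
  rw [sub_eq_add_neg, ← neg_mul]
  refine HasSum.tsum_eq (h.congr_fun fun m ↦ ?_)
  have hm : (0 : ℝ) < m + (μ + 1) := by linarith [m.cast_nonneg (α := ℝ)]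
  have hG := Real.Gamma_pos_of_pos hm
  rw [← add_assoc (m : ℝ) (μ + 1) 1, Real.Gamma_add_one hm.ne']
  field_simp
  ring

theorem besselClifford_sq_le {μ : ℝ} (hμ : -1 < μ) {t : ℝ} (ht : 1 ≤ t) :
    besselClifford μ t ^ 2 ≤ (besselClifford μ 1 ^ 2 + besselClifford (μ + 1) 1 ^ 2) * t := by
  have hderiv (x : ℝ) (hx : 0 < x) :
      HasDerivAt (fun x ↦ besselClifford μ x ^ 2 / x + besselClifford (μ + 1) x ^ 2)
        (-(besselClifford μ x / x) ^ 2 - 2 * (μ + 1) * besselClifford (μ + 1) x ^ 2 / x) x := by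
    have h₀ := hasDerivAt_besselClifford hμ x
    have h₁ := hasDerivAt_besselClifford (μ := μ + 1) (by linarith) x
    refine (((h₀.pow 2).div (hasDerivAt_id x) hx.ne').add (h₁.pow 2)).congr_deriv ?_
    have hrec : besselClifford (μ + 1 + 1) x =
        ((μ + 1) * besselClifford (μ + 1) x - besselClifford μ x) / x := by
      rw [besselClifford_recurrence hμ x, add_assoc μ, one_add_one_eq_two]
      field_simp
      ring
    simp only [hrec, id, Pi.pow_apply]
    field_simp
    ring
  have hanti : AntitoneOn
      (fun x ↦ besselClifford μ x ^ 2 / x + besselClifford (μ + 1) x ^ 2) (Ici 1) := by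
    refine antitoneOn_of_hasDerivWithinAt_nonpos (convex_Ici 1)
      (fun x hx ↦ (hderiv x (zero_lt_one.trans_le hx)).continuousAt.continuousWithinAt)
      (fun x hx ↦ (hderiv x ?_).hasDerivWithinAt) fun x hx ↦ ?_
    all_goals
      rw [interior_Ici] at hx
      have hx₀ : 0 < x := zero_lt_one.trans hx
    · exact hx₀
    · have : 0 ≤ 2 * (μ + 1) * besselClifford (μ + 1) x ^ 2 / x := by
        have : 0 ≤ μ + 1 := by linarith
        positivity
      nlinarith [sq_nonneg (besselClifford μ x / x)]
  have h := hanti self_mem_Ici ht ht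
  simp only [div_one] at h
  rw [← div_le_iff₀ (by linarith)]
  nlinarith [sq_nonneg (besselClifford (μ + 1) t)]

theorem continuous_besselClifford {μ : ℝ} (hμ : -1 < μ) : Continuous (besselClifford μ) :=
  continuous_iff_continuousAt.2 fun t ↦ (hasDerivAt_besselClifford hμ t).continuousAt

theorem exists_abs_besselClifford_le {μ : ℝ} (hμ : -1 < μ) :
    ∃ C, ∀ t, 0 ≤ t → |besselClifford μ t| ≤ C * (1 + t) := by
  obtain ⟨M, hM⟩ := isCompact_Icc.exists_bound_of_continuousOn (s := Icc (0 : ℝ) 1)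
    (continuous_besselClifford hμ).continuousOn
  set E := besselClifford μ 1 ^ 2 + besselClifford (μ + 1) 1 ^ 2
  have hE : 0 ≤ E := by positivity
  have hM₀ : 0 ≤ M := (norm_nonneg _).trans (hM 0 (by simp))
  refine ⟨M + E + 1, fun t ht ↦ ?_⟩
  rcases le_total t 1 with h | h
  · have := hM t ⟨ht, h⟩
    rw [Real.norm_eq_abs] at this
    nlinarith
  · have := besselClifford_sq_le hμ h
    rw [← sq_abs] at this
    nlinarith [sq_nonneg (|besselClifford μ t| - 1)]

theorem besselJ_eq_rpow_mul_besselClifford (ν : ℝ) {x : ℝ} (hx : 0 < x) :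
    besselJ ν x = (x / 2) ^ ν * besselClifford ν ((x / 2) ^ 2) := by
  rw [besselJ, besselClifford, ← tsum_mul_left]
  refine tsum_congr fun m ↦ ?_
  rw [Real.rpow_add (by positivity), ← Nat.cast_ofNat, ← Nat.cast_mul, Real.rpow_natCast, pow_mul,
    add_assoc]
  simp only [Nat.cast_ofNat, div_eq_mul_inv, mul_inv]
  ring

end BesselClifford

section Laplace

open Set Filter Topology MeasureTheory

theorem Real.hasSum_Gamma_add_mul_pow_div_factorial {s x : ℝ} (hs : 0 < s) (hx : |x| < 1) :
    HasSum (fun m : ℕ ↦ Real.Gamma (m + s) / m.factorial * x ^ m)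
      (Real.Gamma s / (1 - x) ^ s) := by
  have hasc (m : ℕ) : Real.Gamma s * (ascPochhammer ℝ m).eval s = Real.Gamma (m + s) := by
    induction m with
    | zero => simp
    | succ m ih =>
      have : (m : ℝ) + s ≠ 0 := by positivity
      rw [ascPochhammer_succ_eval, ← mul_assoc, ih, Nat.cast_succ, add_right_comm,
        Real.Gamma_add_one this]
      ring
  have hmem : x ∈ Metric.eball (0 : ℝ) 1 := by
    simpa [Metric.mem_eball, edist_zero_right, enorm_eq_nnnorm, ← NNReal.coe_lt_one] using hx
  have h := ((Real.one_div_one_sub_rpow_hasFPowerSeriesOnBall_zero s).hasSum hmem).mul_left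
    (Real.Gamma s)
  rw [zero_add, mul_one_div] at h
  refine h.congr_fun fun m ↦ ?_
  have hc := Ring.factorial_nsmul_multichoose_eq_ascPochhammer s m
  rw [Polynomial.ascPochhammer_smeval_eq_eval, nsmul_eq_mul, Ring.multichoose_eq] at hc
  have : (m.factorial : ℝ) ≠ 0 := by positivity
  rw [FormalMultilinearSeries.ofScalars_apply_eq, smul_eq_mul, ← hasc m, ← hc]
  field_simp

theorem integrableOn_rpow_mul_exp_neg_mul {s b : ℝ} (hs : -1 < s) (hb : 0 < b) :
    IntegrableOn (fun x : ℝ ↦ x ^ s * Real.exp (-b * x)) (Ioi 0) := by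
  simpa using integrableOn_rpow_mul_exp_neg_mul_rpow hs one_pos hb

theorem differentiableOn_integral_mul_cexp_neg_mul {h : ℝ → ℝ}
    (hmeas : AEStronglyMeasurable h (volume.restrict (Ioi 0)))
    (hint : ∀ ε > 0, IntegrableOn (fun k ↦ |h k| * Real.exp (-ε * k)) (Ioi 0)) :
    DifferentiableOn ℂ (fun a : ℂ ↦ ∫ k in Ioi (0 : ℝ), (h k : ℂ) * Complex.exp (-a * k))
      {a | 0 < a.re} := by
  intro a ha
  have ha' : 0 < a.re / 4 := by have : 0 < a.re := ha; positivity
  set ε := a.re / 4 with hε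
  have hmeas' : AEStronglyMeasurable (fun k ↦ (h k : ℂ)) (volume.restrict (Ioi 0)) :=
    Complex.continuous_ofReal.comp_aestronglyMeasurable hmeas
  have hs : {z : ℂ | 2 * ε < z.re} ∈ 𝓝 a :=
    (isOpen_lt continuous_const Complex.continuous_re).mem_nhds (by
      simp only [mem_ofPred_eq]
      linarith)
  have hF (z : ℂ) : AEStronglyMeasurable (fun k : ℝ ↦ (h k : ℂ) * Complex.exp (-z * k))
      (volume.restrict (Ioi 0)) :=
    hmeas'.mul (by fun_prop : Continuous fun k : ℝ ↦ Complex.exp (-z * k)).aestronglyMeasurable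
  refine DifferentiableAt.differentiableWithinAt (HasDerivAt.differentiableAt
    (hasDerivAt_integral_of_dominated_loc_of_deriv_le (F := fun (z : ℂ) (k : ℝ) ↦
      (h k : ℂ) * Complex.exp (-z * k))
    (F' := fun z k ↦ (h k : ℂ) * (Complex.exp (-z * k) * (-1 * k)))
    (bound := fun k ↦ ε⁻¹ * (|h k| * Real.exp (-ε * k))) hs (.of_forall hF) ?_ ?_ ?_ ?_ ?_).2)
  · refine (hint a.re ha).mono' (hF a) (.of_forall fun k ↦ ?_)
    simp [Complex.norm_exp]
  · exact hmeas'.mul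
      (by fun_prop : Continuous fun k : ℝ ↦ Complex.exp (-a * k) * (-1 * k)).aestronglyMeasurable
  · filter_upwards [ae_restrict_mem measurableSet_Ioi] with k hk z hz
    have hk : 0 < k := hk
    have hz : 2 * ε < z.re := hz
    have h₁ : Real.exp (-(z.re * k)) ≤ Real.exp (-ε * k) * Real.exp (-(ε * k)) := by
      rw [← Real.exp_add]
      exact Real.exp_le_exp.2 (by nlinarith)
    have h₂ : Real.exp (-(ε * k)) * k ≤ ε⁻¹ := by
      rw [Real.exp_neg, inv_mul_le_iff₀ (Real.exp_pos _), ← div_eq_mul_inv, le_div_iff₀ ha']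
      linarith [Real.add_one_le_exp (ε * k)]
    have : ‖(h k : ℂ) * (Complex.exp (-z * k) * (-1 * k))‖ =
        |h k| * (Real.exp (-(z.re * k)) * k) := by
      simp [Complex.norm_exp, abs_of_pos hk]
    rw [this]
    calc |h k| * (Real.exp (-(z.re * k)) * k)
        ≤ |h k| * (Real.exp (-ε * k) * Real.exp (-(ε * k)) * k) := by gcongr
      _ = (Real.exp (-(ε * k)) * k) * (|h k| * Real.exp (-ε * k)) := by ring
      _ ≤ ε⁻¹ * (|h k| * Real.exp (-ε * k)) := by gcongr
  · exact (hint ε ha').const_mul _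
  · filter_upwards with k z _
    exact ((((hasDerivAt_id z).neg.mul_const (k : ℂ)).cexp).const_mul _)

end Laplace

section HankelIntegral

open Set Filter Topology MeasureTheory

theorem Gamma_two_mul_mul_pow_div_Gamma {ν r a : ℝ} (hν : -1 < ν) (ha : 0 < a) (e : ℝ) (m : ℕ) :
    e ^ m / Real.Gamma (m + (ν + 1)) * (((r / 2) ^ 2) ^ m / m.factorial) *
        ((1 / a) ^ (2 * (m + (ν + 1))) * Real.Gamma (2 * (m + (ν + 1)))) =
      2 ^ (2 * ν + 1) / √Real.pi * (1 / a) ^ (2 * (ν + 1)) *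
        (Real.Gamma (m + (ν + 3 / 2)) / m.factorial * (e * (r / a) ^ 2) ^ m) := by
  have hq : (0 : ℝ) < m + (ν + 1) := by linarith [m.cast_nonneg (α := ℝ)]
  have hG := Real.Gamma_pos_of_pos hq
  have hdup := Real.Gamma_mul_Gamma_add_half (m + (ν + 1))
  have h₁ : (2 : ℝ) ^ (1 - 2 * (m + (ν + 1))) = ((2 ^ 2) ^ m * 2 ^ (2 * ν + 1))⁻¹ := by
    rw [← pow_mul, ← Real.rpow_natCast, ← Real.rpow_add two_pos, ← Real.rpow_neg two_pos.le]
    congr 1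
    push_cast
    ring
  have h₂ : (1 / a) ^ (2 * (m + (ν + 1))) = ((1 / a) ^ 2) ^ m * (1 / a) ^ (2 * (ν + 1)) := by
    rw [← pow_mul, ← Real.rpow_natCast, ← Real.rpow_add (by positivity)]
    congr 1
    push_cast
    ring
  have hpi : 0 < √Real.pi := Real.sqrt_pos.2 Real.pi_pos
  rw [show (m : ℝ) + (ν + 1) + 1 / 2 = m + (ν + 3 / 2) by ring, h₁] at hdup
  have h₃ : Real.Gamma (m + (ν + 3 / 2)) = Real.Gamma (2 * (m + (ν + 1))) * √Real.pi /
      ((2 ^ 2) ^ m * 2 ^ (2 * ν + 1) * Real.Gamma (m + (ν + 1))) := by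
    rw [eq_div_iff (by positivity)]
    linear_combination (2 ^ 2) ^ m * 2 ^ (2 * ν + 1) * hdup +
      Real.Gamma (2 * (m + (ν + 1))) * √Real.pi *
        inv_mul_cancel₀ (show (2 ^ 2) ^ m * (2 : ℝ) ^ (2 * ν + 1) ≠ 0 by positivity)
  rw [h₂, h₃]
  simp only [div_pow, mul_pow, one_div, inv_pow]
  field_simp

theorem integral_rpow_mul_besselClifford_mul_exp {ν r a : ℝ} (hν : -1 < ν) (hr : 0 < r)
    (ha : r < a) :
    ∫ k in Ioi (0 : ℝ), k ^ (2 * ν + 1) * besselClifford ν ((r * k / 2) ^ 2) * Real.exp (-a * k) =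
      2 ^ (2 * ν + 1) / √Real.pi * (1 / a) ^ (2 * (ν + 1)) *
        (Real.Gamma (ν + 3 / 2) / (1 + (r / a) ^ 2) ^ (ν + 3 / 2)) := by
  have ha₀ : 0 < a := hr.trans ha
  have hx : |(r / a) ^ 2| < 1 := by
    rw [abs_of_nonneg (by positivity), sq_lt_one_iff₀ (by positivity), div_lt_one ha₀]
    exact ha
  set K : ℕ → ℝ := fun m ↦
    (-1) ^ m / Real.Gamma (m + (ν + 1)) * (((r / 2) ^ 2) ^ m / m.factorial)
  have hq (m : ℕ) : (0 : ℝ) < 2 * (m + (ν + 1)) := by linarith [m.cast_nonneg (α := ℝ)]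
  have hint (c : ℝ) (m : ℕ) : ∫ k in Ioi (0 : ℝ), c * (k ^ (2 * (m + (ν + 1)) - 1) *
      Real.exp (-(a * k))) = c * ((1 / a) ^ (2 * (m + (ν + 1))) * Real.Gamma (2 * (m + (ν + 1)))) := by
    rw [integral_const_mul, Real.integral_rpow_mul_exp_neg_mul_Ioi (hq m) ha₀]
  have habs (m : ℕ) : |K m| =
      1 ^ m / Real.Gamma (m + (ν + 1)) * (((r / 2) ^ 2) ^ m / m.factorial) := by
    have := Real.Gamma_pos_of_pos (show (0 : ℝ) < m + (ν + 1) by linarith [hq m])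
    simp only [K, abs_mul, abs_div, abs_pow, abs_neg, abs_one, Nat.abs_cast, abs_of_pos this,
      abs_of_pos hr, Nat.abs_ofNat]
  have hsum := hasSum_integral_of_summable_integral_norm (μ := volume.restrict (Ioi 0))
    (F := fun m k ↦ K m * (k ^ (2 * (m + (ν + 1)) - 1) * Real.exp (-(a * k))))
    (fun m ↦ by
      simpa only [neg_mul] using (integrableOn_rpow_mul_exp_neg_mul
        (by linarith [hq m] : -1 < 2 * (m + (ν + 1)) - 1) ha₀).const_mul (K m))
    (by
      have h := ((Real.hasSum_Gamma_add_mul_pow_div_factorial (s := ν + 3 / 2) (by linarith)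
        hx).summable.mul_left (2 ^ (2 * ν + 1) / √Real.pi * (1 / a) ^ (2 * (ν + 1))))
      refine h.congr fun m ↦ ?_
      rw [← one_mul ((r / a) ^ 2), ← Gamma_two_mul_mul_pow_div_Gamma hν ha₀, ← habs, ← hint]
      refine setIntegral_congr_fun measurableSet_Ioi fun k hk ↦ ?_
      have : 0 < k := hk
      simp only [norm_mul, Real.norm_eq_abs, Real.abs_exp, abs_of_pos (Real.rpow_pos_of_pos this _)])
  simp only [hint, K, Gamma_two_mul_mul_pow_div_Gamma hν ha₀] at hsum
  have hval := (Real.hasSum_Gamma_add_mul_pow_div_factorial (s := ν + 3 / 2)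
    (x := -1 * (r / a) ^ 2) (by linarith) (by simpa using hx)).mul_left
    (2 ^ (2 * ν + 1) / √Real.pi * (1 / a) ^ (2 * (ν + 1)))
  rw [show 1 - -1 * (r / a) ^ 2 = 1 + (r / a) ^ 2 by ring] at hval
  rw [← hsum.unique hval]
  refine setIntegral_congr_fun measurableSet_Ioi fun k hk ↦ ?_
  have hk : 0 < k := hk
  rw [besselClifford, ← tsum_mul_left, ← tsum_mul_right]
  refine tsum_congr fun m ↦ ?_
  rw [show 2 * ((m : ℝ) + (ν + 1)) - 1 = (2 * ν + 1) + (2 * m : ℕ) by push_cast; ring,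
    Real.rpow_add hk (2 * ν + 1), Real.rpow_natCast, pow_mul]
  simp only [div_pow, mul_pow, neg_mul]
  ring

theorem integral_rpow_mul_besselClifford_mul_exp_eq {ν r a : ℝ} (hν : -1 < ν) (hr : 0 < r)
    (ha : r < a) :
    (r / 2) ^ ν * ∫ k in Ioi (0 : ℝ),
        k ^ (2 * ν + 1) * besselClifford ν ((r * k / 2) ^ 2) * Real.exp (-a * k) =
      2 * a * (2 * r) ^ ν * Real.Gamma (ν + 3 / 2) /
        (√Real.pi * (a ^ 2 + r ^ 2) ^ (ν + 3 / 2)) := by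
  have ha₀ : 0 < a := hr.trans ha
  have h₁ : (a ^ 2 + r ^ 2) ^ (ν + 3 / 2) =
      a * a ^ (2 * (ν + 1)) * (1 + (r / a) ^ 2) ^ (ν + 3 / 2) := by
    rw [show a ^ 2 + r ^ 2 = a ^ 2 * (1 + (r / a) ^ 2) by field_simp,
      Real.mul_rpow (by positivity) (by positivity), ← Real.rpow_natCast, ← Real.rpow_mul ha₀.le,
      ← Real.rpow_one_add' ha₀.le (by linarith)]
    congr 2
    push_cast
    ring
  have h₂ : (r / 2) ^ ν * 2 ^ (2 * ν + 1) = 2 * (2 * r) ^ ν := by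
    rw [Real.div_rpow hr.le two_pos.le, Real.mul_rpow two_pos.le hr.le, Real.rpow_add two_pos,
      two_mul ν, Real.rpow_add two_pos, Real.rpow_one]
    field_simp
  rw [integral_rpow_mul_besselClifford_mul_exp hν hr ha, h₁, one_div, Real.inv_rpow ha₀.le,
    ← mul_assoc, ← mul_assoc, ← mul_div_assoc ((r / 2) ^ ν), h₂]
  have hpi : 0 < √Real.pi := Real.sqrt_pos.2 Real.pi_pos
  have hpow : 0 < (1 + (r / a) ^ 2) ^ (ν + 3 / 2) := by positivity
  field_simp

theorem integrableOn_abs_rpow_mul_besselClifford_mul_exp {ν ε : ℝ} (hν : -1 < ν) (r : ℝ)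
    (hε : 0 < ε) :
    IntegrableOn (fun k ↦ |k ^ (2 * ν + 1) * besselClifford ν ((r * k / 2) ^ 2)| *
      Real.exp (-ε * k)) (Ioi 0) := by
  obtain ⟨C, hC⟩ := exists_abs_besselClifford_le hν
  have h₁ := integrableOn_rpow_mul_exp_neg_mul (by linarith : -1 < 2 * ν + 1) hε
  have h₂ := integrableOn_rpow_mul_exp_neg_mul (by linarith : -1 < 2 * ν + 3) hε
  have hcont := continuous_besselClifford hν
  refine ((h₁.const_mul C).add (h₂.const_mul (C * (r / 2) ^ 2))).mono'
    (by fun_prop) ?_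
  filter_upwards [ae_restrict_mem measurableSet_Ioi] with k hk
  have hk : 0 < k := hk
  have hpow : k ^ (2 * ν + 3) = k ^ (2 * ν + 1) * k ^ 2 := by
    rw [← Real.rpow_natCast, ← Real.rpow_add hk]
    congr 1
    push_cast
    ring
  rw [norm_mul, Real.norm_eq_abs, Real.norm_eq_abs, Real.abs_exp, abs_abs, abs_mul,
    abs_of_pos (Real.rpow_pos_of_pos hk _)]
  calc k ^ (2 * ν + 1) * |besselClifford ν ((r * k / 2) ^ 2)| * Real.exp (-ε * k)
      ≤ k ^ (2 * ν + 1) * (C * (1 + (r * k / 2) ^ 2)) * Real.exp (-ε * k) := by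
        gcongr
        exact hC _ (by positivity)
    _ = _ := by
        simp only [Pi.add_apply, hpow]
        ring

theorem add_sq_mem_slitPlane {a : ℂ} (ha : 0 < a.re) (r : ℝ) :
    a ^ 2 + (r : ℂ) ^ 2 ∈ Complex.slitPlane := by
  rw [Complex.mem_slitPlane_iff]
  by_cases h : a.im = 0
  · left
    simp only [sq, Complex.add_re, Complex.mul_re, Complex.ofReal_re, Complex.ofReal_im, h]
    nlinarith [mul_self_nonneg r]
  · right
    simp only [sq, Complex.add_im, Complex.mul_im, Complex.ofReal_re, Complex.ofReal_im]
    intro h'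
    exact mul_ne_zero ha.ne' h (by linarith)

end HankelIntegral

theorem hankel_exponential_integral (a : ℂ) (ha : 0 < a.re) (ν : ℝ) (hν : -1 < ν)
    (r : ℝ) (hr : 0 < r) :
    ∫ k in Set.Ioi (0 : ℝ),
        (k : ℂ) ^ (ν + 1 : ℂ) * (besselJ ν (r * k) : ℂ) * Complex.exp (-a * k)
      = 2 * a * ((2 * r : ℝ) : ℂ) ^ (ν : ℂ) * (Real.Gamma (ν + 3 / 2) : ℂ) /
          ((Real.sqrt Real.pi : ℂ) * (a ^ 2 + (r : ℂ) ^ 2) ^ (ν + 3 / 2 : ℂ)) := by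
  set h : ℝ → ℝ := fun k ↦ k ^ (2 * ν + 1) * besselClifford ν ((r * k / 2) ^ 2) with h_def
  have hcont := continuous_besselClifford hν
  have hmeas : MeasureTheory.AEStronglyMeasurable h
      (MeasureTheory.volume.restrict (Set.Ioi 0)) := by
    fun_prop
  set L : ℂ → ℂ := fun z ↦ (((r / 2) ^ ν : ℝ) : ℂ) *
    ∫ k in Set.Ioi (0 : ℝ), (h k : ℂ) * Complex.exp (-z * k) with hL_def
  set R : ℂ → ℂ := fun z ↦ 2 * z * ((2 * r : ℝ) : ℂ) ^ (ν : ℂ) * (Real.Gamma (ν + 3 / 2) : ℂ) /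
    ((Real.sqrt Real.pi : ℂ) * (z ^ 2 + (r : ℂ) ^ 2) ^ (ν + 3 / 2 : ℂ)) with hR_def
  have hopen : IsOpen {z : ℂ | 0 < z.re} := isOpen_lt continuous_const Complex.continuous_re
  have hL : DifferentiableOn ℂ L {z | 0 < z.re} :=
    (differentiableOn_integral_mul_cexp_neg_mul hmeas fun ε hε ↦
      integrableOn_abs_rpow_mul_besselClifford_mul_exp hν r hε).const_mul _
  have hR : DifferentiableOn ℂ R {z | 0 < z.re} := by
    intro z hz
    have hslit := add_sq_mem_slitPlane hz r
    have hpow : DifferentiableAt ℂ (fun z : ℂ ↦ (z ^ 2 + (r : ℂ) ^ 2) ^ (ν + 3 / 2 : ℂ)) z :=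
      DifferentiableAt.cpow_const (by fun_prop) hslit
    refine (DifferentiableAt.div (by fun_prop) (hpow.const_mul _) ?_).differentiableWithinAt
    exact mul_ne_zero (by simp [Real.sqrt_eq_zero', Real.pi_pos])
      (by simp [Complex.cpow_eq_zero_iff, Complex.slitPlane_ne_zero hslit])
  have hreal (x : ℝ) (hx : r < x) : L x = R x := by
    have hx₀ : 0 ≤ x ^ 2 + r ^ 2 := by positivity
    have := congrArg Complex.ofReal (integral_rpow_mul_besselClifford_mul_exp_eq hν hr hx)
    rw [Complex.ofReal_mul, ← integral_complex_ofReal] at this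
    simp only [Complex.ofReal_mul, Complex.ofReal_div, Complex.ofReal_cpow hx₀,
      Complex.ofReal_cpow (by positivity : 0 ≤ 2 * r)] at this
    simpa [hL_def, hR_def, h_def] using this
  have hfreq : ∃ᶠ z in nhdsWithin ((r + 1 : ℝ) : ℂ) {((r + 1 : ℝ) : ℂ)}ᶜ, L z = R z := by
    have ht : Filter.Tendsto Complex.ofReal (nhdsWithin (r + 1) {r + 1}ᶜ)
        (nhdsWithin ((r + 1 : ℝ) : ℂ) {((r + 1 : ℝ) : ℂ)}ᶜ) :=
      Complex.continuous_ofReal.continuousWithinAt.tendsto_nhdsWithin fun x hx ↦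
        Complex.ofReal_injective.ne hx
    refine ht.frequently (Filter.Eventually.frequently ?_)
    filter_upwards [nhdsWithin_le_nhds (lt_mem_nhds (lt_add_one r))] with x hx using hreal x hx
  have hLR := (hL.analyticOnNhd hopen).eqOn_of_preconnected_of_frequently_eq
    (hR.analyticOnNhd hopen) (convex_halfSpace_re_gt 0).isPreconnected
    (z₀ := ((r + 1 : ℝ) : ℂ)) (by simp; linarith) hfreq ha
  refine Eq.trans ?_ hLR
  simp only [hL_def]
  rw [← MeasureTheory.integral_const_mul]
  refine MeasureTheory.setIntegral_congr_fun measurableSet_Ioi fun k hk ↦ ?_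
  have hk : 0 < k := hk
  have hpow : k ^ (ν + 1) * besselJ ν (r * k) = (r / 2) ^ ν * h k := by
    rw [besselJ_eq_rpow_mul_besselClifford ν (mul_pos hr hk), mul_div_right_comm,
      Real.mul_rpow (by positivity) hk.le]
    simp only [h_def, show 2 * ν + 1 = ν + 1 + ν by ring, Real.rpow_add hk (ν + 1) ν,
      mul_div_right_comm]
    ring
  rw [← mul_assoc, ← Complex.ofReal_mul, ← hpow, Complex.ofReal_mul, Complex.ofReal_cpow hk.le,
    Complex.ofReal_add, Complex.ofReal_one]
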